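/- Let n ≥ 1, Q = 2n+2, and suppose 1 < p < ∞, 1 < q' < ∞, q is the Hölder conjugate of q' (1/q + 1/q' = 1), p' is the Hölder conjugate of p, 0 < λ < Q, α + β ≥ 0, λ + α + β ≤ Q, β < Q/p', α < Q/q, and 1/p + 1/q' + (λ+α+β)/Q = 2. Let (g_i) be a sequence of nonnegative functions with ‖g_i(v)·|v|^{β}‖_{L^p(ℍⁿ)} = 1 which is tight in the sense that for every δ > 0 there exists R > 0 such that ∫_{B_ℍ(0,R)} |g_i(v)|^p |v|^{βp} dv ≥ 1 − δ for all i, and suppose g_i(v)|v|^{β} converges weakly in L^p(ℍⁿ) to g(v)|v|^{β}. Then, after passing to a subsequence, I_λ(g_i)(u)·|u|^{-α} → I_λ(g)(u)·|u|^{-α} for almost every u ∈ ℍⁿ. -/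

import Mathlib

open MeasureTheory ENNReal Filter

noncomputable section

/-- The Heisenberg group `ℍⁿ = ℂⁿ × ℝ` (as a measure space, with Lebesgue/Haar measure). -/
abbrev Hn (n : ℕ) := (Fin n → ℂ) × ℝ

/-- Euclidean norm of the `ℂⁿ` component. -/
def znorm {n : ℕ} (z : Fin n → ℂ) : ℝ := Real.sqrt (∑ j, Complex.normSq (z j))

/-- Homogeneous norm `|u| = (|z|⁴ + t²)^{1/4}` on the Heisenberg group. -/
def Hnorm {n : ℕ} (u : Hn n) : ℝ := (znorm u.1 ^ 4 + u.2 ^ 2) ^ ((1 : ℝ)/4)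

/-- Heisenberg group law `(z,t)·(z',t') = (z+z', t+t'+2 Im (z ⬝ conj z'))`. -/
def Hmul {n : ℕ} (u v : Hn n) : Hn n :=
  (u.1 + v.1, u.2 + v.2 + 2 * (∑ j, u.1 j * (starRingEnd ℂ) (v.1 j)).im)

/-- Heisenberg group inverse `(z,t)⁻¹ = (-z,-t)`. -/
def Hinv {n : ℕ} (u : Hn n) : Hn n := (-u.1, -u.2)

/-- Left-invariant quasi-distance `d(u,v) = |u⁻¹ v|`. -/
def Hdist {n : ℕ} (u v : Hn n) : ℝ := Hnorm (Hmul (Hinv u) v)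

/-- Heisenberg ball `B_ℍ(u,R)`. -/
def Hball {n : ℕ} (u : Hn n) (R : ℝ) : Set (Hn n) := {v | Hdist u v < R}

/-- Fractional integral operator `I_λ(g)(u) = ∫ g(v)/|u⁻¹v|^λ dv`. -/
def Ilam {n : ℕ} (lam : ℝ) (g : Hn n → ℝ) (u : Hn n) : ℝ :=
  ∫ v, g v / Hdist u v ^ lam

section Geometry

variable {n : ℕ}

lemma znorm_eq_norm_toLp (z : Fin n → ℂ) : znorm z = ‖WithLp.toLp 2 z‖ := by
  rw [EuclideanSpace.norm_eq, znorm]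
  simp [Complex.normSq_eq_norm_sq]

lemma znorm_nonneg (z : Fin n → ℂ) : 0 ≤ znorm z := Real.sqrt_nonneg _

lemma znorm_add_le (z w : Fin n → ℂ) : znorm (z + w) ≤ znorm z + znorm w := by
  simp only [znorm_eq_norm_toLp, WithLp.toLp_add]
  exact norm_add_le _ _

lemma abs_im_sum_mul_conj_le (z w : Fin n → ℂ) :
    |(∑ j, z j * (starRingEnd ℂ) (w j)).im| ≤ znorm z * znorm w := by
  have h : ∑ j, z j * (starRingEnd ℂ) (w j)
      = inner ℂ (WithLp.toLp 2 w) (WithLp.toLp 2 z) := by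
    simp [PiLp.inner_apply]
  rw [h, znorm_eq_norm_toLp, znorm_eq_norm_toLp, mul_comm]
  exact (Complex.abs_im_le_norm _).trans (norm_inner_le_norm _ _)

lemma norm_le_znorm (z : Fin n → ℂ) : ‖z‖ ≤ znorm z := by
  refine (pi_norm_le_iff_of_nonneg (znorm_nonneg z)).2 fun j => ?_
  rw [znorm_eq_norm_toLp]
  exact PiLp.norm_apply_le (WithLp.toLp 2 z) j

lemma Hnorm_nonneg (u : Hn n) : 0 ≤ Hnorm u := by
  unfold Hnorm; positivity

lemma Hnorm_pow_four (u : Hn n) : Hnorm u ^ 4 = znorm u.1 ^ 4 + u.2 ^ 2 := by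
  unfold Hnorm
  rw [← Real.rpow_natCast, ← Real.rpow_mul (by positivity)]
  norm_num

lemma znorm_le_Hnorm (u : Hn n) : znorm u.1 ≤ Hnorm u := by
  refine le_of_pow_le_pow_left₀ (n := 4) (by norm_num) (Hnorm_nonneg u) ?_
  rw [Hnorm_pow_four]
  nlinarith [sq_nonneg u.2]

lemma abs_snd_le_Hnorm_sq (u : Hn n) : |u.2| ≤ Hnorm u ^ 2 := by
  refine abs_le_of_sq_le_sq ?_ (pow_nonneg (Hnorm_nonneg u) 2)
  have h := Hnorm_pow_four u
  have : 0 ≤ znorm u.1 ^ 4 := by positivity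
  nlinarith

lemma Hdist_nonneg (u v : Hn n) : 0 ≤ Hdist u v := Hnorm_nonneg _

lemma Hmul_Hinv_cancel (u v : Hn n) : Hmul u (Hmul (Hinv u) v) = v := by
  have h : (∑ j, u.1 j * (starRingEnd ℂ) (u.1 j)).im = 0 := by
    simp [Complex.mul_conj]
  simp only [Hmul, Hinv, Pi.add_apply, Pi.neg_apply, map_add, map_neg, mul_add, neg_mul, mul_neg,
    Finset.sum_add_distrib, Finset.sum_neg_distrib, Complex.add_im, Complex.neg_im, h]
  ext <;> simp
  ring

lemma Hnorm_Hmul_le (u v : Hn n) : Hnorm (Hmul u v) ≤ 2 * (Hnorm u + Hnorm v) := by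
  have ha := Hnorm_nonneg u
  have hb := Hnorm_nonneg v
  refine le_of_pow_le_pow_left₀ (n := 4) (by norm_num) (by positivity) ?_
  rw [Hnorm_pow_four]
  have h1 : znorm (Hmul u v).1 ≤ Hnorm u + Hnorm v :=
    (znorm_add_le _ _).trans (add_le_add (znorm_le_Hnorm u) (znorm_le_Hnorm v))
  have h2 : |(Hmul u v).2| ≤ (Hnorm u + Hnorm v) ^ 2 := by
    have h3 : |(∑ j, u.1 j * (starRingEnd ℂ) (v.1 j)).im| ≤ Hnorm u * Hnorm v :=
      (abs_im_sum_mul_conj_le _ _).trans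
        (mul_le_mul (znorm_le_Hnorm u) (znorm_le_Hnorm v) (znorm_nonneg _) ha)
    have h4 := abs_snd_le_Hnorm_sq u
    have h5 := abs_snd_le_Hnorm_sq v
    simp only [Hmul]
    rw [abs_le] at *
    constructor <;> nlinarith
  have h6 : znorm (Hmul u v).1 ^ 4 ≤ (Hnorm u + Hnorm v) ^ 4 :=
    pow_le_pow_left₀ (znorm_nonneg _) h1 4
  have h7 : (Hmul u v).2 ^ 2 ≤ ((Hnorm u + Hnorm v) ^ 2) ^ 2 :=
    sq_le_sq' (abs_le.1 h2).1 (abs_le.1 h2).2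
  have h8 : 0 ≤ (Hnorm u + Hnorm v) ^ 4 := by positivity
  nlinarith

lemma Hnorm_le_Hdist (u v : Hn n) : Hnorm v ≤ 2 * (Hnorm u + Hdist u v) := by
  conv_lhs => rw [← Hmul_Hinv_cancel u v]
  exact Hnorm_Hmul_le _ _

lemma continuous_Hnorm : Continuous (Hnorm : Hn n → ℝ) := by
  unfold Hnorm znorm
  refine Continuous.rpow_const ?_ fun _ => Or.inr (by norm_num)
  simp only [Complex.normSq_apply]
  fun_prop

lemma continuous_Hdist : Continuous fun x : Hn n × Hn n => Hdist x.1 x.2 := by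
  refine continuous_Hnorm.comp ?_
  simp only [Hmul, Hinv]
  fun_prop

lemma measurePreserving_Hmul_Hinv (v : Hn n) :
    MeasurePreserving (fun u : Hn n => Hmul (Hinv u) v) := by
  have h := MeasurePreserving.skew_product
    (Measure.measurePreserving_sub_left (volume : Measure (Fin n → ℂ)) v.1)
    (μc := (volume : Measure ℝ)) (μd := (volume : Measure ℝ))
    (g := fun (a : Fin n → ℂ) t => (v.2 + 2 * (∑ j, -a j * (starRingEnd ℂ) (v.1 j)).im) - t)
    (by simp only [Function.uncurry_def]; fun_prop)
    (Eventually.of_forall fun a => (Measure.measurePreserving_sub_left volume _).map_eq)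
  have e : (fun u : Hn n => Hmul (Hinv u) v) = fun u : Hn n =>
      (v.1 - u.1, (v.2 + 2 * (∑ j, -u.1 j * (starRingEnd ℂ) (v.1 j)).im) - u.2) := by
    ext u <;> simp [Hmul, Hinv] <;> ring
  rw [e]
  exact h

/-- Homogeneous balls of radius `r` have volume at most a constant times `r ^ (2 n + 2)`. -/
lemma exists_volume_Hnorm_le (n : ℕ) : ∃ C : ℝ≥0∞, C ≠ ∞ ∧ ∀ r : ℝ, 0 ≤ r →
    volume {v : Hn n | Hnorm v ≤ r} ≤ C * ENNReal.ofReal (r ^ (2 * n + 2 : ℝ)) := by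
  refine ⟨2 * volume (Metric.ball (0 : Fin n → ℂ) 1),
    ENNReal.mul_ne_top (by simp) measure_ball_lt_top.ne, fun r hr => ?_⟩
  have hsub : {v : Hn n | Hnorm v ≤ r} ⊆
      Metric.closedBall (0 : Fin n → ℂ) r ×ˢ Set.Icc (-r ^ 2) (r ^ 2) := by
    intro v hv
    refine ⟨?_, ?_⟩
    · simpa using ((norm_le_znorm v.1).trans (znorm_le_Hnorm v)).trans hv
    · have := (abs_snd_le_Hnorm_sq v).trans (pow_le_pow_left₀ (Hnorm_nonneg v) hv 2)
      exact abs_le.1 this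
  refine (measure_mono hsub).trans ?_
  rw [Measure.volume_eq_prod, Measure.prod_prod, Measure.addHaar_closedBall _ _ hr,
    Real.volume_Icc]
  have h1 : Module.finrank ℝ (Fin n → ℂ) = 2 * n := by
    rw [Module.finrank_pi_fintype]; simp [mul_comm]
  have h2 : r ^ (2 * n + 2 : ℝ) = r ^ (2 * n) * r ^ 2 := by
    rw [← pow_add, ← Real.rpow_natCast]; push_cast; rfl
  rw [h1, h2, ENNReal.ofReal_mul (by positivity), show r ^ 2 - -r ^ 2 = 2 * r ^ 2 by ring,
    ENNReal.ofReal_mul (by norm_num)]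
  simp only [ENNReal.ofReal_ofNat]
  apply le_of_eq; ring

end Geometry

section Radial

variable {n : ℕ}

lemma measurable_Hnorm : Measurable (Hnorm : Hn n → ℝ) := continuous_Hnorm.measurable

lemma Real.rpow_neg_le_of_shell {x s a : ℝ} (hx : s / 2 ≤ x) (hxs : x ≤ s) (hs : 0 < s) :
    x ^ (-a) ≤ 2 ^ |a| * s ^ (-a) := by
  have hx0 : 0 < x := by linarith
  have h2 : (1 : ℝ) ≤ 2 ^ |a| := Real.one_le_rpow (by norm_num) (abs_nonneg a)
  rcases le_or_gt 0 a with ha | ha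
  · calc x ^ (-a) ≤ (s / 2) ^ (-a) :=
          Real.rpow_le_rpow_of_nonpos (by positivity) hx (by linarith)
      _ = 2 ^ |a| * s ^ (-a) := by
          rw [Real.div_rpow hs.le (by norm_num), Real.rpow_neg (by norm_num : (0:ℝ) ≤ 2),
            abs_of_nonneg ha]
          field_simp
  · calc x ^ (-a) ≤ s ^ (-a) := Real.rpow_le_rpow hx0.le hxs (by linarith)
      _ ≤ 2 ^ |a| * s ^ (-a) := le_mul_of_one_le_left (by positivity) h2

lemma exists_lintegral_shell_le (n : ℕ) (a : ℝ) : ∃ C : ℝ≥0∞, C ≠ ∞ ∧ ∀ s : ℝ, 0 < s →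
    ∫⁻ v in {v : Hn n | s / 2 ≤ Hnorm v ∧ Hnorm v ≤ s}, ENNReal.ofReal (Hnorm v ^ (-a))
      ≤ C * ENNReal.ofReal (s ^ (2 * n + 2 - a : ℝ)) := by
  obtain ⟨C, hC, hvol⟩ := exists_volume_Hnorm_le n
  refine ⟨ENNReal.ofReal (2 ^ |a|) * C, ENNReal.mul_ne_top ofReal_ne_top hC, fun s hs => ?_⟩
  calc ∫⁻ v in {v : Hn n | s / 2 ≤ Hnorm v ∧ Hnorm v ≤ s}, ENNReal.ofReal (Hnorm v ^ (-a))
      ≤ ∫⁻ v in {v : Hn n | s / 2 ≤ Hnorm v ∧ Hnorm v ≤ s},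
          ENNReal.ofReal (2 ^ |a| * s ^ (-a)) :=
        setLIntegral_mono measurable_const fun v hv =>
          ENNReal.ofReal_le_ofReal (Real.rpow_neg_le_of_shell hv.1 hv.2 hs)
    _ ≤ ENNReal.ofReal (2 ^ |a| * s ^ (-a)) *
          (C * ENNReal.ofReal (s ^ (2 * n + 2 : ℝ))) := by
        rw [setLIntegral_const]
        gcongr
        exact (measure_mono fun v hv => hv.2).trans (hvol s hs.le)
    _ = _ := by
        rw [sub_eq_neg_add, Real.rpow_add hs (-a), ENNReal.ofReal_mul (by positivity),
          ENNReal.ofReal_mul (by positivity)]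
        ring

lemma ae_Hnorm_pos : ∀ᵐ v : Hn n, 0 < Hnorm v := by
  obtain ⟨C, -, hvol⟩ := exists_volume_Hnorm_le n
  have h := hvol 0 le_rfl
  rw [Real.zero_rpow (by positivity)] at h
  simpa [ae_iff] using h

lemma tsum_geometric_ofReal_ne_top {r : ℝ} (hr : 0 ≤ r) (hr1 : r < 1) :
    ∑' k : ℕ, ENNReal.ofReal (r ^ k) ≠ ∞ :=
  (summable_geometric_of_lt_one hr hr1).tsum_ofReal_ne_top

lemma tsum_shell_ne_top {C : ℝ≥0∞} (hC : C ≠ ∞) {R c b : ℝ} (hR : 0 < R) (hc : 0 < c)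
    (hcb : c ^ b < 1) : ∑' k : ℕ, C * ENNReal.ofReal ((R * c ^ k) ^ b) ≠ ∞ := by
  have h : ∀ k : ℕ, C * ENNReal.ofReal ((R * c ^ k) ^ b)
      = C * ENNReal.ofReal (R ^ b) * ENNReal.ofReal ((c ^ b) ^ k) := by
    intro k
    rw [Real.mul_rpow hR.le (by positivity), ENNReal.ofReal_mul (by positivity), mul_assoc,
      ← Real.rpow_natCast, ← Real.rpow_natCast, ← Real.rpow_mul hc.le, ← Real.rpow_mul hc.le,
      mul_comm (k : ℝ)]
  simp_rw [h]
  rw [ENNReal.tsum_mul_left]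
  exact ENNReal.mul_ne_top (ENNReal.mul_ne_top hC ofReal_ne_top)
    (tsum_geometric_ofReal_ne_top (by positivity) hcb)

lemma lintegral_ball_Hnorm_rpow_ne_top {a R : ℝ} (ha : a < 2 * n + 2) (hR : 0 < R) :
    ∫⁻ v in {v : Hn n | Hnorm v ≤ R}, ENNReal.ofReal (Hnorm v ^ (-a)) ≠ ∞ := by
  obtain ⟨C, hC, hsh⟩ := exists_lintegral_shell_le n a
  have hsub : {v : Hn n | Hnorm v ≤ R} ≤ᵐ[volume]
      (⋃ k : ℕ, {v : Hn n | R * (1 / 2) ^ k / 2 ≤ Hnorm v ∧ Hnorm v ≤ R * (1 / 2) ^ k} : Set _) := by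
    filter_upwards [ae_Hnorm_pos] with v hv hvR
    have hvR : Hnorm v ≤ R := hvR
    obtain ⟨k, hk1, hk2⟩ := exists_nat_pow_near_of_lt_one (y := (1 / 2 : ℝ))
      (div_pos hv hR) ((div_le_one hR).2 hvR) (by norm_num) (by norm_num)
    rw [lt_div_iff₀ hR] at hk1
    rw [div_le_iff₀ hR] at hk2
    refine Set.mem_iUnion.2 ⟨k, ?_, ?_⟩
    · rw [pow_succ] at hk1; linarith
    · linarith
  refine ne_top_of_le_ne_top ?_ ((lintegral_mono_set' hsub).trans (lintegral_iUnion_le _ _))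
  refine ne_top_of_le_ne_top (tsum_shell_ne_top (b := 2 * n + 2 - a) (c := 1 / 2) hC hR
    (by norm_num) ?_) (ENNReal.tsum_le_tsum fun k => hsh _ (by positivity))
  exact Real.rpow_lt_one (by norm_num) (by norm_num) (by linarith)

lemma lintegral_compl_ball_Hnorm_rpow_ne_top {a R : ℝ} (ha : 2 * n + 2 < a) (hR : 0 < R) :
    ∫⁻ v in {v : Hn n | R < Hnorm v}, ENNReal.ofReal (Hnorm v ^ (-a)) ≠ ∞ := by
  obtain ⟨C, hC, hsh⟩ := exists_lintegral_shell_le n a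
  have hsub : {v : Hn n | R < Hnorm v} ⊆
      (⋃ k : ℕ, {v : Hn n | 2 * R * 2 ^ k / 2 ≤ Hnorm v ∧ Hnorm v ≤ 2 * R * 2 ^ k}) := by
    intro v (hvR : R < Hnorm v)
    obtain ⟨k, hk1, hk2⟩ := exists_nat_pow_near ((one_le_div hR).2 hvR.le) one_lt_two
    rw [le_div_iff₀ hR] at hk1
    rw [div_lt_iff₀ hR, pow_succ] at hk2
    refine Set.mem_iUnion.2 ⟨k, ?_, ?_⟩ <;> linarith
  refine ne_top_of_le_ne_top ?_ ((lintegral_mono_set hsub).trans (lintegral_iUnion_le _ _))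
  refine ne_top_of_le_ne_top (tsum_shell_ne_top (b := 2 * n + 2 - a) (c := 2) (R := 2 * R) hC
    (by positivity) (by norm_num) ?_) (ENNReal.tsum_le_tsum fun k => hsh _ (by positivity))
  exact Real.rpow_lt_one_of_one_lt_of_neg (by norm_num) (by linarith)

end Radial

section Truncation

variable {n : ℕ}

/-- The potential `Ilam` with the kernel `d ^ (-lam)` truncated to `max d ε ^ (-lam)`. -/
def truncIlam (lam ε : ℝ) (f : Hn n → ℝ) (u : Hn n) : ℝ :=
  ∫ v, f v * max (Hdist u v) ε ^ (-lam)

/-- The part of the kernel `x ^ (-lam)` removed by truncation at `ε`. -/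
def kernelDefect (lam ε x : ℝ) : ℝ≥0∞ := ‖x ^ (-lam) - max x ε ^ (-lam)‖ₑ

lemma measurable_kernelDefect (lam ε : ℝ) : Measurable (kernelDefect lam ε) := by
  unfold kernelDefect; fun_prop

lemma kernelDefect_of_le {lam ε x : ℝ} (h : ε ≤ x) : kernelDefect lam ε x = 0 := by
  simp [kernelDefect, max_eq_left h]

lemma kernelDefect_le {lam ε x : ℝ} (hlam : 0 ≤ lam) (hx : 0 < x) :
    kernelDefect lam ε x ≤ ENNReal.ofReal (x ^ (-lam)) := by
  rw [kernelDefect, Real.enorm_eq_ofReal_abs]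
  have h1 : max x ε ^ (-lam) ≤ x ^ (-lam) :=
    Real.rpow_le_rpow_of_nonpos hx (le_max_left _ _) (by linarith)
  have h2 : 0 ≤ max x ε ^ (-lam) := Real.rpow_nonneg (hx.le.trans (le_max_left _ _)) _
  rw [abs_of_nonneg (by linarith)]
  exact ENNReal.ofReal_le_ofReal (by linarith)

lemma measurable_truncKernel (lam ε : ℝ) :
    Measurable fun x : Hn n × Hn n => max (Hdist x.1 x.2) ε ^ (-lam) :=
  (continuous_Hdist.measurable.max measurable_const).pow_const _

lemma measurable_truncKernel_right (lam ε : ℝ) (u : Hn n) :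
    Measurable fun v : Hn n => max (Hdist u v) ε ^ (-lam) :=
  Measurable.comp (g := fun x : Hn n × Hn n => max (Hdist x.1 x.2) ε ^ (-lam))
    (f := fun v => (u, v)) (measurable_truncKernel lam ε) measurable_prodMk_left

lemma measurable_Hdist_right (u : Hn n) : Measurable fun v : Hn n => Hdist u v :=
  Measurable.comp (g := fun x : Hn n × Hn n => Hdist x.1 x.2) (f := fun v => (u, v))
    continuous_Hdist.measurable measurable_prodMk_left

lemma Hdist_zero (v : Hn n) : Hdist 0 v = Hnorm v := by
  simp [Hdist, Hmul, Hinv]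

lemma memLp_truncKernel {lam β p ε : ℝ} (hlam : 0 < lam) (hp : 0 < p) (hε : 0 < ε)
    (hβ : β * p < 2 * n + 2) (hlamβ : 2 * n + 2 < (lam + β) * p) (u : Hn n) :
    MemLp (fun v : Hn n => Hnorm v ^ (-β) * max (Hdist u v) ε ^ (-lam)) (ENNReal.ofReal p) := by
  have hmeas : Measurable fun v : Hn n => Hnorm v ^ (-β) * max (Hdist u v) ε ^ (-lam) :=
    (measurable_Hnorm.pow_const _).mul (measurable_truncKernel_right lam ε u)
  refine ⟨hmeas.aestronglyMeasurable, ?_⟩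
  rw [eLpNorm_lt_top_iff_lintegral_rpow_enorm_lt_top (by simpa using hp) ofReal_ne_top,
    ENNReal.toReal_ofReal hp.le]
  have hlp : 0 ≤ lam * p := by positivity
  have hmax : ∀ v, 0 < max (Hdist u v) ε := fun v => hε.trans_le (le_max_right _ _)
  have hval : ∀ v : Hn n, ‖Hnorm v ^ (-β) * max (Hdist u v) ε ^ (-lam)‖ₑ ^ p =
      ENNReal.ofReal (Hnorm v ^ (-(β * p))) *
        ENNReal.ofReal (max (Hdist u v) ε ^ (-(lam * p))) := by
    intro v
    have h1 := Real.rpow_nonneg (Hnorm_nonneg v) (-β)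
    have h2 := (Real.rpow_pos_of_pos (hmax v) (-lam)).le
    rw [Real.enorm_eq_ofReal (mul_nonneg h1 h2),
      ENNReal.ofReal_rpow_of_nonneg (mul_nonneg h1 h2) hp.le,
      Real.mul_rpow h1 h2, ← Real.rpow_mul (Hnorm_nonneg v), ← Real.rpow_mul (hmax v).le,
      ENNReal.ofReal_mul (Real.rpow_nonneg (Hnorm_nonneg v) _), neg_mul, neg_mul]
  simp_rw [hval]
  set R : ℝ := 4 * Hnorm u + 1 with hR
  have hR0 : 0 < R := by have := Hnorm_nonneg u; positivity
  have hA : MeasurableSet {v : Hn n | Hnorm v ≤ R} :=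
    measurableSet_le measurable_Hnorm measurable_const
  rw [← lintegral_add_compl _ hA]
  refine ENNReal.add_lt_top.2 ⟨?_, ?_⟩
  · refine lt_of_le_of_lt (b := ∫⁻ v in {v : Hn n | Hnorm v ≤ R},
      ENNReal.ofReal (Hnorm v ^ (-(β * p))) * ENNReal.ofReal (ε ^ (-(lam * p)))) ?_ ?_
    · refine lintegral_mono fun v => ?_
      refine mul_le_mul' le_rfl (ENNReal.ofReal_le_ofReal ?_)
      exact Real.rpow_le_rpow_of_nonpos hε (le_max_right _ _) (by linarith)
    · rw [lintegral_mul_const _ (measurable_Hnorm.pow_const _).ennreal_ofReal]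
      exact ENNReal.mul_lt_top (lintegral_ball_Hnorm_rpow_ne_top hβ hR0).lt_top ofReal_lt_top
  · refine lt_of_le_of_lt (b := ∫⁻ v in {v : Hn n | R < Hnorm v},
      ENNReal.ofReal (Hnorm v ^ (-((lam + β) * p))) * ENNReal.ofReal (4 ^ (lam * p))) ?_ ?_
    · have hc : {v : Hn n | Hnorm v ≤ R}ᶜ = {v : Hn n | R < Hnorm v} := by ext; simp
      rw [hc]
      refine setLIntegral_mono (by
        exact ((measurable_Hnorm.pow_const _).ennreal_ofReal).mul_const _)
        fun v (hv : R < Hnorm v) => ?_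
      have hv0 : 0 < Hnorm v := hR0.trans hv
      rw [← ENNReal.ofReal_mul (by positivity), ← ENNReal.ofReal_mul (by positivity)]
      refine ENNReal.ofReal_le_ofReal ?_
      have h4 : Hnorm v / 4 ≤ max (Hdist u v) ε := by
        have := Hnorm_le_Hdist u v
        exact le_trans (by linarith) (le_max_left _ _)
      calc Hnorm v ^ (-(β * p)) * max (Hdist u v) ε ^ (-(lam * p))
          ≤ Hnorm v ^ (-(β * p)) * (Hnorm v / 4) ^ (-(lam * p)) := by
            gcongr ?_ * ?_
            exact Real.rpow_le_rpow_of_nonpos (by positivity) h4 (by linarith)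
        _ = Hnorm v ^ (-((lam + β) * p)) * 4 ^ (lam * p) := by
            rw [Real.div_rpow hv0.le (by norm_num), Real.rpow_neg (by norm_num : (0:ℝ) ≤ 4),
              div_inv_eq_mul, ← mul_assoc, ← Real.rpow_add hv0]
            ring_nf
    · rw [lintegral_mul_const _ (measurable_Hnorm.pow_const _).ennreal_ofReal]
      exact ENNReal.mul_lt_top (lintegral_compl_ball_Hnorm_rpow_ne_top hlamβ hR0).lt_top
        ofReal_lt_top

lemma enorm_Ilam_sub_truncIlam_le {lam ε : ℝ} {f : Hn n → ℝ} {u : Hn n}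
    (hf : AEStronglyMeasurable f) (hint : Integrable fun v => f v * max (Hdist u v) ε ^ (-lam)) :
    ‖Ilam lam f u - truncIlam lam ε f u‖ₑ ≤ ∫⁻ v, ‖f v‖ₑ * kernelDefect lam ε (Hdist u v) := by
  rcases eq_or_ne (∫⁻ v, ‖f v‖ₑ * kernelDefect lam ε (Hdist u v)) ∞ with h | h
  · rw [h]; exact le_top
  have heq : ∀ v, ‖f v * (Hdist u v ^ (-lam) - max (Hdist u v) ε ^ (-lam))‖ₑ =
      ‖f v‖ₑ * kernelDefect lam ε (Hdist u v) := fun v => by rw [enorm_mul, kernelDefect]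
  have hd : Integrable fun v => f v * (Hdist u v ^ (-lam) - max (Hdist u v) ε ^ (-lam)) := by
    refine ⟨hf.mul (((measurable_Hdist_right u).pow_const _).sub
      (measurable_truncKernel_right lam ε u)).aestronglyMeasurable, ?_⟩
    rw [hasFiniteIntegral_iff_enorm]
    simp_rw [heq]
    exact h.lt_top
  have hsum : Ilam lam f u = truncIlam lam ε f u +
      ∫ v, f v * (Hdist u v ^ (-lam) - max (Hdist u v) ε ^ (-lam)) := by
    rw [truncIlam, ← integral_add hint hd, Ilam]
    congr 1 with v
    rw [Real.rpow_neg (Hdist_nonneg u v)]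
    ring
  rw [hsum, add_sub_cancel_left]
  refine (enorm_integral_le_lintegral_enorm _).trans ?_
  simp_rw [heq]
  exact le_rfl

lemma tendsto_lintegral_kernelDefect {lam : ℝ} (hlam : 0 < lam) (hlamQ : lam < 2 * n + 2) :
    Tendsto (fun k : ℕ => ∫⁻ w : Hn n, kernelDefect lam (1 / ((k : ℝ) + 1)) (Hnorm w))
      atTop (nhds 0) := by
  obtain ⟨C, hC, hvol⟩ := exists_volume_Hnorm_le n
  have hA : ∀ r : ℝ, MeasurableSet {v : Hn n | Hnorm v ≤ r} := fun r =>
    measurableSet_le measurable_Hnorm measurable_const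
  have hball : Tendsto (fun k : ℕ => volume {w : Hn n | Hnorm w ≤ 1 / ((k : ℝ) + 1)})
      atTop (nhds 0) := by
    refine tendsto_of_tendsto_of_tendsto_of_le_of_le tendsto_const_nhds ?_ (fun _ => zero_le)
      (fun k => hvol _ (by positivity))
    have h1 : Tendsto (fun k : ℕ => (1 / ((k : ℝ) + 1)) ^ (2 * n + 2 : ℝ)) atTop (nhds 0) := by
      have := (tendsto_one_div_add_atTop_nhds_zero_nat (𝕜 := ℝ)).rpow_const
        (p := 2 * n + 2) (Or.inr (by positivity))
      rwa [Real.zero_rpow (by positivity)] at this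
    have h2 := ENNReal.Tendsto.const_mul (ENNReal.tendsto_ofReal h1) (Or.inr hC)
    simpa using h2
  have h := tendsto_setLIntegral_zero (lintegral_ball_Hnorm_rpow_ne_top hlamQ one_pos)
    (μ := volume.restrict {v : Hn n | Hnorm v ≤ 1})
    (s := fun k : ℕ => {w : Hn n | Hnorm w ≤ 1 / ((k : ℝ) + 1)}) (l := atTop)
    (tendsto_of_tendsto_of_tendsto_of_le_of_le tendsto_const_nhds hball (fun _ => zero_le)
      fun k => Measure.restrict_apply_le _ _)
  refine tendsto_of_tendsto_of_tendsto_of_le_of_le tendsto_const_nhds h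
    (fun _ => zero_le) fun k => ?_
  have hsub : {w : Hn n | Hnorm w ≤ 1 / ((k : ℝ) + 1)} ⊆ {v : Hn n | Hnorm v ≤ 1} := fun w hw =>
    le_trans (show Hnorm w ≤ 1 / ((k : ℝ) + 1) from hw)
      ((div_le_one (by positivity)).2 (by linarith [(Nat.cast_nonneg k : (0 : ℝ) ≤ k)]))
  rw [Measure.restrict_restrict (hA _), Set.inter_eq_left.2 hsub, ← lintegral_indicator (hA _)]
  refine lintegral_mono_ae ?_
  filter_upwards [ae_Hnorm_pos] with w hw
  by_cases hwk : Hnorm w ≤ 1 / ((k : ℝ) + 1)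
  · rw [Set.indicator_of_mem (show w ∈ {w : Hn n | Hnorm w ≤ 1 / ((k : ℝ) + 1)} from hwk)]
    exact kernelDefect_le hlam.le hw
  · rw [kernelDefect_of_le (not_le.1 hwk).le]
    exact zero_le

lemma aemeasurable_enorm_mul_kernelDefect {lam ε : ℝ} {f : Hn n → ℝ}
    (hf : AEStronglyMeasurable f) (s : Set (Hn n)) :
    AEMeasurable (Function.uncurry fun u v => ‖f v‖ₑ * kernelDefect lam ε (Hdist u v))
      ((volume.restrict s).prod volume) := by
  refine AEMeasurable.mul (f := fun x : Hn n × Hn n => ‖f x.2‖ₑ)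
    (g := fun x : Hn n × Hn n => kernelDefect lam ε (Hdist x.1 x.2)) ?_ ?_
  · exact (hf.comp_snd).enorm
  · exact ((measurable_kernelDefect lam ε).comp continuous_Hdist.measurable).aemeasurable

lemma aemeasurable_lintegral_kernelDefect {lam ε : ℝ} {f : Hn n → ℝ}
    (hf : AEStronglyMeasurable f) (s : Set (Hn n)) :
    AEMeasurable (fun u => ∫⁻ v, ‖f v‖ₑ * kernelDefect lam ε (Hdist u v)) (volume.restrict s) :=
  (aemeasurable_enorm_mul_kernelDefect hf s).lintegral_prod_right'

lemma stronglyMeasurable_truncIlam {lam : ℝ} {f : Hn n → ℝ} (hf : Measurable f) (ε : ℝ) :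
    StronglyMeasurable (truncIlam lam ε f) :=
  StronglyMeasurable.integral_prod_right (f := fun u v => f v * max (Hdist u v) ε ^ (-lam))
    (((hf.comp measurable_snd).mul (measurable_truncKernel lam ε)).stronglyMeasurable)

lemma lintegral_lintegral_kernelDefect_le {lam ε R : ℝ} (hε : ε ≤ 1) {f : Hn n → ℝ}
    (hf : AEStronglyMeasurable f) :
    ∫⁻ u in {u : Hn n | Hnorm u ≤ R}, ∫⁻ v, ‖f v‖ₑ * kernelDefect lam ε (Hdist u v) ≤
      (∫⁻ v in {v : Hn n | Hnorm v ≤ 2 * (R + 1)}, ‖f v‖ₑ) *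
        ∫⁻ w : Hn n, kernelDefect lam ε (Hnorm w) := by
  have hA : ∀ r : ℝ, MeasurableSet {v : Hn n | Hnorm v ≤ r} := fun r =>
    measurableSet_le measurable_Hnorm measurable_const
  rw [lintegral_lintegral_swap (aemeasurable_enorm_mul_kernelDefect hf _),
    ← lintegral_indicator (hA _), ← lintegral_mul_const'' _ (hf.enorm.indicator (hA _))]
  refine lintegral_mono fun v => ?_
  by_cases hv : Hnorm v ≤ 2 * (R + 1)
  · rw [Set.indicator_of_mem (show v ∈ {v : Hn n | Hnorm v ≤ 2 * (R + 1)} from hv)]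
    have hm := (measurePreserving_Hmul_Hinv v)
    have hk : ∫⁻ u, kernelDefect lam ε (Hdist u v) = ∫⁻ w : Hn n, kernelDefect lam ε (Hnorm w) :=
      hm.lintegral_comp ((measurable_kernelDefect lam ε).comp measurable_Hnorm)
    rw [← hk, lintegral_const_mul' _ _ enorm_ne_top]
    gcongr
    exact Measure.restrict_le_self
  · refine le_of_eq_of_le ?_ zero_le
    rw [setLIntegral_eq_zero_iff (hA _)]
    · refine Eventually.of_forall fun u (hu : Hnorm u ≤ R) => ?_
      have := Hnorm_le_Hdist u v
      rw [kernelDefect_of_le (by linarith), mul_zero]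
    · exact (((measurable_kernelDefect lam ε).comp continuous_Hdist.measurable).comp
        measurable_prodMk_right).const_mul _

lemma lintegral_ball_enorm_le {lam R : ℝ} (hR : 0 < R) (f : Hn n → ℝ) :
    ∫⁻ v in {v : Hn n | Hnorm v ≤ R}, ‖f v‖ₑ ≤
      ENNReal.ofReal (R ^ lam) * ∫⁻ v, ‖f v * max (Hdist 0 v) R ^ (-lam)‖ₑ := by
  rw [← lintegral_const_mul' _ _ ofReal_ne_top]
  refine le_trans (setLIntegral_mono' (measurableSet_le measurable_Hnorm measurable_const)
    fun v (hv : Hnorm v ≤ R) => ?_) (setLIntegral_le_lintegral {v : Hn n | Hnorm v ≤ R} _)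
  rw [Hdist_zero, max_eq_right hv, enorm_mul, Real.enorm_eq_ofReal (by positivity : 0 ≤ R ^ (-lam)),
    mul_left_comm, ← ENNReal.ofReal_mul (by positivity), ← Real.rpow_add hR]
  simp

end Truncation

section Convergence

/-- Convergence in measure of a sequence that is uniformly approximated in `L¹` by sequences
converging in measure. -/
lemma tendstoInMeasure_of_approx {X : Type*} [MeasurableSpace X] {μ : Measure X}
    {F : ℕ → X → ℝ} {f : X → ℝ} {T : ℕ → ℕ → X → ℝ} {t : ℕ → X → ℝ}
    {N : ℕ → ℕ → X → ℝ≥0∞} {N₀ : ℕ → X → ℝ≥0∞} {c c₀ : ℕ → ℝ≥0∞}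
    (hT : ∀ k, TendstoInMeasure μ (T k) atTop (t k))
    (hN : ∀ k i, AEMeasurable (N k i) μ) (hN₀ : ∀ k, AEMeasurable (N₀ k) μ)
    (hF : ∀ k i x, edist (F i x) (T k i x) ≤ N k i x) (hf : ∀ k x, edist (f x) (t k x) ≤ N₀ k x)
    (hNc : ∀ k i, ∫⁻ x, N k i x ∂μ ≤ c k) (hNc₀ : ∀ k, ∫⁻ x, N₀ k x ∂μ ≤ c₀ k)
    (hc : Tendsto c atTop (nhds 0)) (hc₀ : Tendsto c₀ atTop (nhds 0)) :
    TendstoInMeasure μ F atTop f := by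
  intro δ' hδ'
  set δ : ℝ≥0∞ := min δ' 1 / 3 with hδdef
  have hδ0 : δ ≠ 0 := (ENNReal.div_pos (lt_min hδ' one_pos).ne' (by simp)).ne'
  have hδtop : δ ≠ ∞ :=
    ENNReal.div_ne_top (ne_top_of_le_ne_top one_ne_top (min_le_right _ _)) (by simp)
  have h3 : δ + δ + δ ≤ δ' := by rw [hδdef, ENNReal.add_thirds]; exact min_le_left _ _
  rw [ENNReal.tendsto_nhds_zero]
  intro η hη
  have hη3 : 0 < η / 3 := ENNReal.div_pos hη.ne' (by simp)
  have hc' : Tendsto (fun k => c k / δ) atTop (nhds 0) := by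
    simpa using ENNReal.Tendsto.div_const hc (Or.inr hδ0)
  have hc₀' : Tendsto (fun k => c₀ k / δ) atTop (nhds 0) := by
    simpa using ENNReal.Tendsto.div_const hc₀ (Or.inr hδ0)
  obtain ⟨k, hk, hk₀⟩ := ((ENNReal.tendsto_nhds_zero.1 hc' _ hη3).and
    (ENNReal.tendsto_nhds_zero.1 hc₀' _ hη3)).exists
  filter_upwards [ENNReal.tendsto_nhds_zero.1 (hT k δ (pos_iff_ne_zero.2 hδ0)) _ hη3] with i hi
  have hsub : {x | δ' ≤ edist (F i x) (f x)} ⊆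
      {x | δ ≤ N k i x} ∪ {x | δ ≤ edist (T k i x) (t k x)} ∪ {x | δ ≤ N₀ k x} := by
    intro x (hx : δ' ≤ edist (F i x) (f x))
    by_contra hcon
    simp only [Set.mem_union, Set.mem_ofPred_eq, not_or, not_le] at hcon
    obtain ⟨⟨h1, h2⟩, h4⟩ := hcon
    have h5 : edist (t k x) (f x) < δ := by rw [edist_comm]; exact (hf k x).trans_lt h4
    have := (edist_triangle4 (F i x) (T k i x) (t k x) (f x)).trans_lt
      (ENNReal.add_lt_add (ENNReal.add_lt_add ((hF k i x).trans_lt h1) h2) h5)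
    exact absurd (hx.trans_lt this) (not_lt.2 h3)
  calc μ {x | δ' ≤ edist (F i x) (f x)}
      ≤ μ {x | δ ≤ N k i x} + μ {x | δ ≤ edist (T k i x) (t k x)} + μ {x | δ ≤ N₀ k x} :=
        (measure_mono hsub).trans ((measure_union_le _ _).trans
          (add_le_add (measure_union_le _ _) le_rfl))
    _ ≤ η / 3 + η / 3 + η / 3 := by
        refine add_le_add (add_le_add ?_ hi) ?_
        · exact ((meas_ge_le_lintegral_div (hN k i) hδ0 hδtop).trans
            (ENNReal.div_le_div_right (hNc k i) _)).trans hk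
        · exact ((meas_ge_le_lintegral_div (hN₀ k) hδ0 hδtop).trans
            (ENNReal.div_le_div_right (hNc₀ k) _)).trans hk₀
    _ = η := ENNReal.add_thirds η

/-- Local convergence in measure along an exhaustion gives a subsequence converging almost
everywhere. -/
lemma exists_seq_tendsto_ae_of_exhaustion {X : Type*} [MeasurableSpace X] {μ : Measure X}
    {E : ℕ → Set X} (hE : ∀ j, MeasurableSet (E j)) (hEx : ∀ x, ∀ᶠ j in atTop, x ∈ E j)
    {F : ℕ → X → ℝ} {f : X → ℝ} (h : ∀ j, TendstoInMeasure (μ.restrict (E j)) F atTop f) :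
    ∃ ψ : ℕ → ℕ, StrictMono ψ ∧
      ∀ᵐ x ∂μ, Tendsto (fun i => F (ψ i) x) atTop (nhds (f x)) := by
  have hev : ∀ m : ℕ, ∃ M, ∀ k ≥ M, μ ({x | ((m : ℝ≥0∞) + 1)⁻¹ ≤ edist (F k x) (f x)} ∩ E m)
      ≤ 2⁻¹ ^ m := by
    intro m
    have hm := ENNReal.tendsto_nhds_zero.1 (h m ((m : ℝ≥0∞) + 1)⁻¹ (by simp)) (2⁻¹ ^ m)
      (ENNReal.pow_pos (by simp) _)
    simp_rw [Measure.restrict_apply' (hE m)] at hm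
    exact eventually_atTop.1 hm
  obtain ⟨ψ, hψ, hψm⟩ := extraction_forall_of_eventually' hev
  refine ⟨ψ, hψ, ?_⟩
  have hsum : ∑' m : ℕ, μ ({x | ((m : ℝ≥0∞) + 1)⁻¹ ≤ edist (F (ψ m) x) (f x)} ∩ E m) ≠ ∞ := by
    refine ne_top_of_le_ne_top ?_ (ENNReal.tsum_le_tsum hψm)
    rw [ENNReal.tsum_geometric]
    simp
  filter_upwards [ae_eventually_notMem hsum] with x hx
  rw [tendsto_iff_edist_tendsto_0]
  have hlim : Tendsto (fun m : ℕ => ((m : ℝ≥0∞) + 1)⁻¹) atTop (nhds 0) := by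
    have := (tendsto_add_atTop_iff_nat 1).2 ENNReal.tendsto_inv_nat_nhds_zero
    simpa using this
  refine tendsto_of_tendsto_of_tendsto_of_le_of_le' tendsto_const_nhds hlim
    (Eventually.of_forall fun _ => zero_le) ?_
  filter_upwards [hx, hEx x] with m hm hmE
  by_contra hcon
  exact hm ⟨(not_le.1 hcon).le, hmE⟩

variable {n : ℕ}

/-- Pointwise convergence of all truncated potentials gives almost everywhere convergence of a
subsequence of the potentials. -/
lemma exists_seq_tendsto_ae_Ilam {lam : ℝ} (hlam : 0 < lam) (hlamQ : lam < 2 * n + 2)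
    {g : ℕ → Hn n → ℝ} {h : Hn n → ℝ} (hg : ∀ i, Measurable (g i)) (hpos : ∀ i v, 0 ≤ g i v)
    (hh : AEStronglyMeasurable h)
    (hgint : ∀ i u ε, 0 < ε → Integrable fun v => g i v * max (Hdist u v) ε ^ (-lam))
    (hhint : ∀ u ε, 0 < ε → Integrable fun v => h v * max (Hdist u v) ε ^ (-lam))
    (hlim : ∀ u ε, 0 < ε →
      Tendsto (fun i => truncIlam lam ε (g i) u) atTop (nhds (truncIlam lam ε h u))) :
    ∃ ψ : ℕ → ℕ, StrictMono ψ ∧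
      ∀ᵐ u, Tendsto (fun i => Ilam lam (g (ψ i)) u) atTop (nhds (Ilam lam h u)) := by
  have hA : ∀ r : ℝ, MeasurableSet {v : Hn n | Hnorm v ≤ r} := fun r =>
    measurableSet_le measurable_Hnorm measurable_const
  refine exists_seq_tendsto_ae_of_exhaustion (μ := volume) (F := fun i => Ilam lam (g i))
    (f := Ilam lam h) (E := fun j : ℕ => {u : Hn n | Hnorm u ≤ j}) (fun j => hA j)
    (fun u => ?_) fun j => ?_
  · obtain ⟨m, hm⟩ := exists_nat_ge (Hnorm u)
    filter_upwards [eventually_ge_atTop m] with j hj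
    exact hm.trans (Nat.cast_le.2 hj)
  set R : ℝ := 2 * ((j : ℝ) + 1)
  have hR : 0 < R := by positivity
  have hε : ∀ k : ℕ, 0 < 1 / ((k : ℝ) + 1) := fun k => by positivity
  have hε1 : ∀ k : ℕ, 1 / ((k : ℝ) + 1) ≤ 1 := fun k =>
    (div_le_one (by positivity)).2 (by linarith [(Nat.cast_nonneg k : (0 : ℝ) ≤ k)])
  obtain ⟨M, hM⟩ := (hlim 0 R hR).bddAbove_range
  have hgM : ∀ i, ∫⁻ v in {v : Hn n | Hnorm v ≤ R}, ‖g i v‖ₑ ≤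
      ENNReal.ofReal (R ^ lam) * ENNReal.ofReal M := by
    intro i
    refine (lintegral_ball_enorm_le (lam := lam) hR (g i)).trans ?_
    have h0 : ∀ v, 0 ≤ g i v * max (Hdist 0 v) R ^ (-lam) := fun v => mul_nonneg (hpos i v)
      (Real.rpow_nonneg (hR.le.trans (le_max_right _ _)) _)
    gcongr
    rw [← ofReal_integral_norm_eq_lintegral_enorm (hgint i 0 R hR)]
    refine ENNReal.ofReal_le_ofReal (le_trans (le_of_eq ?_) (hM (Set.mem_range_self i)))
    exact integral_congr_ae (Eventually.of_forall fun v => Real.norm_of_nonneg (h0 v))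
  have hhM : ∫⁻ v in {v : Hn n | Hnorm v ≤ R}, ‖h v‖ₑ ≠ ∞ :=
    ne_top_of_le_ne_top (ENNReal.mul_ne_top ofReal_ne_top (hhint 0 R hR).2.ne)
      (lintegral_ball_enorm_le (lam := lam) hR h)
  have hfin : IsFiniteMeasure (volume.restrict {u : Hn n | Hnorm u ≤ j}) := by
    obtain ⟨C, hC, hvol⟩ := exists_volume_Hnorm_le n
    refine ⟨?_⟩
    rw [Measure.restrict_apply_univ]
    exact (hvol j (by positivity)).trans_lt (ENNReal.mul_lt_top hC.lt_top ofReal_lt_top)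
  have hdef := tendsto_lintegral_kernelDefect (n := n) hlam hlamQ
  refine tendstoInMeasure_of_approx
    (T := fun k i => truncIlam lam (1 / ((k : ℝ) + 1)) (g i))
    (t := fun k => truncIlam lam (1 / ((k : ℝ) + 1)) h)
    (N := fun k i u => ∫⁻ v, ‖g i v‖ₑ * kernelDefect lam (1 / ((k : ℝ) + 1)) (Hdist u v))
    (N₀ := fun k u => ∫⁻ v, ‖h v‖ₑ * kernelDefect lam (1 / ((k : ℝ) + 1)) (Hdist u v))
    (fun k => ?_) (fun k i => ?_) (fun k => ?_) (fun k i u => ?_) (fun k u => ?_)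
    (fun k i => (lintegral_lintegral_kernelDefect_le (hε1 k)
      (hg i).aestronglyMeasurable).trans (mul_le_mul' (hgM i) le_rfl))
    (fun k => lintegral_lintegral_kernelDefect_le (hε1 k) hh) ?_ ?_
  · refine tendstoInMeasure_of_tendsto_ae (fun i => ?_)
      (Eventually.of_forall fun u => hlim u _ (hε k))
    exact (stronglyMeasurable_truncIlam (hg i) _).aestronglyMeasurable
  · exact aemeasurable_lintegral_kernelDefect (hg i).aestronglyMeasurable _
  · exact aemeasurable_lintegral_kernelDefect hh _
  · rw [edist_eq_enorm_sub]
    exact enorm_Ilam_sub_truncIlam_le (hg i).aestronglyMeasurable (hgint i u _ (hε k))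
  · rw [edist_eq_enorm_sub]
    exact enorm_Ilam_sub_truncIlam_le hh (hhint u _ (hε k))
  · simpa using ENNReal.Tendsto.const_mul hdef
      (Or.inr (ENNReal.mul_ne_top ofReal_ne_top ofReal_ne_top))
  · simpa using ENNReal.Tendsto.const_mul hdef (Or.inr hhM)

end Convergence

section WeakLimit

/-- If nonnegative functions `G i` converge to `G₀` when tested against all of `Lᵖ`, then the
products `G₀ * φ` with nonnegative `φ ∈ Lᵖ` are integrable, so that the limit integrals are not
junk values. -/
lemma integrable_mul_of_tendsto_integral_mul {X : Type*} [MeasurableSpace X] {μ : Measure X}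
    [SigmaFinite μ] {p : ℝ≥0∞} {G : ℕ → X → ℝ} {G₀ φ : X → ℝ} (hG : ∀ i x, 0 ≤ G i x)
    (hG₀ : AEStronglyMeasurable G₀ μ) (hφ : ∀ x, 0 ≤ φ x) (hφp : MemLp φ p μ)
    (hint : ∀ i, Integrable (fun x => G i x * φ x) μ)
    (hweak : ∀ ψ : X → ℝ, MemLp ψ p μ →
      Tendsto (fun i => ∫ x, G i x * ψ x ∂μ) atTop (nhds (∫ x, G₀ x * ψ x ∂μ))) :
    Integrable (fun x => G₀ x * φ x) μ := by
  by_contra hcon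
  have hlim := hweak φ hφp
  rw [integral_undef hcon] at hlim
  have hw : AEStronglyMeasurable (fun x => G₀ x * φ x) μ := hG₀.mul hφp.1
  set w := hw.mk _
  have hwm : Measurable w := hw.stronglyMeasurable_mk.measurable
  set D : ℕ → Set X := fun N => {x | |w x| ≤ N} ∩ spanningSets μ N
  have hD : ∀ N, MeasurableSet (D N) := fun N =>
    (measurableSet_le hwm.abs measurable_const).inter (measurableSet_spanningSets μ N)
  have hset : ∀ s, MeasurableSet s → ∫ x in s, G₀ x * φ x ∂μ = 0 := by
    intro s hs
    have h1 := hweak _ (hφp.indicator hs)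
    have hmul : ∀ f : X → ℝ, (fun x => f x * s.indicator φ x) = s.indicator fun x => f x * φ x := by
      intro f; ext x; by_cases hx : x ∈ s <;> simp [hx]
    simp_rw [hmul, integral_indicator hs] at h1
    refine tendsto_nhds_unique h1 (squeeze_zero (fun i => ?_) (fun i => ?_) hlim)
    · exact integral_nonneg fun x => mul_nonneg (hG i x) (hφ x)
    · exact setIntegral_le_integral (hint i)
        (Eventually.of_forall fun x => mul_nonneg (hG i x) (hφ x))
  have hzero : ∀ N, ∀ᵐ x ∂μ, x ∈ D N → w x = 0 := by
    intro N
    rw [← ae_restrict_iff' (hD N)]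
    have hfin : IsFiniteMeasure (μ.restrict (D N)) := ⟨by
      rw [Measure.restrict_apply_univ]
      exact (measure_mono Set.inter_subset_right).trans_lt (measure_spanningSets_lt_top μ N)⟩
    have hwint : Integrable w (μ.restrict (D N)) := by
      refine Integrable.of_bound hwm.aestronglyMeasurable N ?_
      filter_upwards [ae_restrict_mem (hD N)] with x hx
      exact hx.1
    refine hwint.ae_eq_zero_of_forall_setIntegral_eq_zero fun s hs _ => ?_
    rw [Measure.restrict_restrict hs, ← hset _ (hs.inter (hD N))]
    exact integral_congr_ae (ae_restrict_of_ae hw.ae_eq_mk.symm)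
  refine hcon ((integrable_zero X ℝ μ).congr ?_)
  filter_upwards [hw.ae_eq_mk, ae_all_iff.2 hzero] with x hx hx0
  rw [hx]
  obtain ⟨N, hN⟩ := exists_nat_ge |w x|
  obtain ⟨M, hM⟩ := Set.mem_iUnion.1 ((iUnion_spanningSets μ).symm ▸ Set.mem_univ x)
  refine (hx0 (max N M) ⟨?_, ?_⟩).symm
  · exact hN.trans (Nat.cast_le.2 (le_max_left _ _))
  · exact monotone_spanningSets μ (le_max_right _ _) hM

variable {n : ℕ}

lemma eq_of_Hdist_eq_zero {u v : Hn n} (h : Hdist u v = 0) : v = u := by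
  have h1 := znorm_le_Hnorm (Hmul (Hinv u) v)
  have h2 := abs_snd_le_Hnorm_sq (Hmul (Hinv u) v)
  have h3 := norm_le_znorm (Hmul (Hinv u) v).1
  change Hnorm _ = 0 at h
  rw [h] at h1 h2
  have h4 : Hmul (Hinv u) v = 0 := Prod.ext
    (norm_le_zero_iff.1 (h3.trans h1)) (abs_nonpos_iff.1 (h2.trans (by norm_num)))
  have h5 := Hmul_Hinv_cancel u v
  rw [h4] at h5
  rw [← h5]
  simp [Hmul]

lemma ae_Hdist_pos (u : Hn n) : ∀ᵐ v, 0 < Hdist u v := by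
  have h0 : volume ({u} : Set (Hn n)) = 0 := by
    rw [← Prod.mk.eta (p := u), ← Set.singleton_prod_singleton, Measure.volume_eq_prod,
      Measure.prod_prod, Real.volume_singleton, mul_zero]
  have h : ∀ᵐ v : Hn n, v ∉ ({u} : Set (Hn n)) := measure_eq_zero_iff_ae_notMem.1 h0
  filter_upwards [h] with v hv
  exact (Hdist_nonneg u v).lt_of_ne fun h0 => hv (eq_of_Hdist_eq_zero h0.symm)

lemma truncIlam_of_not_aestronglyMeasurable {lam ε : ℝ} (hε : 0 < ε) {f : Hn n → ℝ}
    (hf : ¬ AEStronglyMeasurable f) (u : Hn n) : truncIlam lam ε f u = 0 := by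
  refine integral_non_aestronglyMeasurable fun h => hf ?_
  refine (h.mul (measurable_truncKernel_right lam ε u).inv.aestronglyMeasurable).congr
    (Eventually.of_forall fun v => ?_)
  have : max (Hdist u v) ε ^ (-lam) ≠ 0 :=
    (Real.rpow_pos_of_pos (hε.trans_le (le_max_right _ _)) _).ne'
  simp [mul_assoc, mul_inv_cancel₀ this]

lemma Ilam_of_not_aestronglyMeasurable {lam : ℝ} {f : Hn n → ℝ}
    (hf : ¬ AEStronglyMeasurable f) (u : Hn n) : Ilam lam f u = 0 := by
  refine integral_non_aestronglyMeasurable fun h => hf ?_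
  refine (h.mul ((measurable_Hdist_right u).pow_const lam).aestronglyMeasurable).congr ?_
  filter_upwards [ae_Hdist_pos u] with v hv
  exact div_mul_cancel₀ _ (Real.rpow_pos_of_pos hv lam).ne'

end WeakLimit

/-- **Almost-everywhere convergence of the weighted potentials along a tight maximizing
sequence** (Lemma 2.4). -/
theorem weighted_potential_ae_convergence
    (n : ℕ) (hn : 1 ≤ n) (Q p p' q q' lam α β : ℝ) (hQ : Q = 2 * n + 2)
    (hp : 1 < p) (hq' : 1 < q')
    (hq : 1 / q + 1 / q' = 1) (hp' : 1 / p + 1 / p' = 1)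
    (hlam0 : 0 < lam) (hlamQ : lam < Q)
    (hab : 0 ≤ α + β) (habQ : lam + α + β ≤ Q)
    (hβ : β < Q / p') (hα : α < Q / q)
    (hbal : 1 / p + 1 / q' + (lam + α + β) / Q = 2)
    (g : ℕ → Hn n → ℝ) (g₀ : Hn n → ℝ)
    (hmeas : ∀ i, Measurable (g i)) (hpos : ∀ i v, 0 ≤ g i v)
    (hnorm : ∀ i, eLpNorm (fun v => g i v * Hnorm v ^ β) (ENNReal.ofReal p) volume = 1)
    (htight : ∀ δ : ℝ, 0 < δ → ∃ R : ℝ, 0 < R ∧ ∀ i,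
      1 - ENNReal.ofReal δ ≤
        ∫⁻ v in Hball (0 : Hn n) R, ENNReal.ofReal (|g i v| ^ p * Hnorm v ^ (β * p)))
    (hweak : ∀ φ : Hn n → ℝ, MemLp φ (ENNReal.ofReal p') volume →
      Tendsto (fun i => ∫ v, g i v * Hnorm v ^ β * φ v) atTop
        (nhds (∫ v, g₀ v * Hnorm v ^ β * φ v))) :
    ∃ ψ : ℕ → ℕ, StrictMono ψ ∧
      ∀ᵐ u, Tendsto (fun i => Ilam lam (g (ψ i)) u * Hnorm u ^ (-α)) atTop
        (nhds (Ilam lam g₀ u * Hnorm u ^ (-α))) := by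
  have hp0 : 0 < p := by linarith
  have hQ0 : 0 < Q := by rw [hQ]; positivity
  have hp'inv : 0 < 1 / p' := by
    have : 1 / p < 1 := (div_lt_one hp0).2 hp
    linarith
  have hp'0 : 0 < p' := one_div_pos.1 hp'inv
  have hβp : β * p' < 2 * n + 2 := by rwa [lt_div_iff₀ hp'0, hQ] at hβ
  have hlamβ : 2 * n + 2 < (lam + β) * p' := by
    have h1 : α / Q < 1 / q := by
      rw [div_lt_iff₀ hQ0]
      calc α < Q / q := hα
        _ = 1 / q * Q := by ring
    have h2 : (lam + α + β) / Q = (lam + β) / Q + α / Q := by ring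
    have h3 : 1 / p' < (lam + β) / Q := by linarith
    rw [div_lt_div_iff₀ hp'0 hQ0] at h3
    linarith
  have hlamQ' : lam < 2 * n + 2 := hQ ▸ hlamQ
  have hconj : p.HolderConjugate p' := Real.holderConjugate_iff.2 ⟨hp, by simpa using hp'⟩
  have : (ENNReal.ofReal p).HolderConjugate (ENNReal.ofReal p') := hconj.ennrealOfReal
  set φ : Hn n → ℝ → Hn n → ℝ := fun u ε v => Hnorm v ^ (-β) * max (Hdist u v) ε ^ (-lam) with hφ
  have hφp : ∀ u ε, 0 < ε → MemLp (φ u ε) (ENNReal.ofReal p') volume := fun u ε hε =>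
    memLp_truncKernel hlam0 hp'0 hε hβp hlamβ u
  have hφ0 : ∀ u ε, 0 < ε → ∀ v, 0 ≤ φ u ε v := fun u ε hε v =>
    mul_nonneg (Real.rpow_nonneg (Hnorm_nonneg v) _)
      (Real.rpow_nonneg (hε.le.trans (le_max_right _ _)) _)
  have hmulφ : ∀ (f : Hn n → ℝ) u ε, (fun v => f v * Hnorm v ^ β * φ u ε v) =ᵐ[volume]
      fun v => f v * max (Hdist u v) ε ^ (-lam) := by
    intro f u ε
    filter_upwards [ae_Hnorm_pos] with v hv
    rw [hφ]
    calc f v * Hnorm v ^ β * (Hnorm v ^ (-β) * max (Hdist u v) ε ^ (-lam))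
        = f v * max (Hdist u v) ε ^ (-lam) * (Hnorm v ^ β * Hnorm v ^ (-β)) := by ring
      _ = _ := by rw [← Real.rpow_add hv, add_neg_cancel, Real.rpow_zero, mul_one]
  have hGp : ∀ i, MemLp (fun v => g i v * Hnorm v ^ β) (ENNReal.ofReal p) volume := fun i =>
    ⟨((hmeas i).mul (measurable_Hnorm.pow_const β)).aestronglyMeasurable, by
      rw [hnorm i]; exact one_lt_top⟩
  have hGφ : ∀ i u ε, 0 < ε → Integrable fun v => g i v * Hnorm v ^ β * φ u ε v :=
    fun i u ε hε => (hGp i).integrable_mul (hφp u ε hε)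
  have hgint : ∀ i u ε, 0 < ε → Integrable fun v => g i v * max (Hdist u v) ε ^ (-lam) :=
    fun i u ε hε => (hGφ i u ε hε).congr (hmulφ (g i) u ε)
  have hlim : ∀ u ε, 0 < ε →
      Tendsto (fun i => truncIlam lam ε (g i) u) atTop (nhds (truncIlam lam ε g₀ u)) := by
    intro u ε hε
    have h := hweak _ (hφp u ε hε)
    simp_rw [fun f => integral_congr_ae (hmulφ f u ε)] at h
    exact h
  suffices h : ∃ ψ : ℕ → ℕ, StrictMono ψ ∧
      ∀ᵐ u, Tendsto (fun i => Ilam lam (g (ψ i)) u) atTop (nhds (Ilam lam g₀ u)) by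
    obtain ⟨ψ, hψ, hae⟩ := h
    refine ⟨ψ, hψ, ?_⟩
    filter_upwards [hae] with u hu
    exact hu.mul_const _
  by_cases hg₀ : AEStronglyMeasurable g₀ volume
  · refine exists_seq_tendsto_ae_Ilam hlam0 hlamQ' hmeas hpos hg₀ hgint (fun u ε hε => ?_) hlim
    refine (integrable_mul_of_tendsto_integral_mul
      (fun i v => mul_nonneg (hpos i v) (Real.rpow_nonneg (Hnorm_nonneg v) β))
      (hg₀.mul (measurable_Hnorm.pow_const β).aestronglyMeasurable) (hφ0 u ε hε) (hφp u ε hε)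
      (fun i => hGφ i u ε hε) hweak).congr (hmulφ g₀ u ε)
  · have h := exists_seq_tendsto_ae_Ilam (h := fun _ => 0) hlam0 hlamQ' hmeas hpos
      aestronglyMeasurable_const hgint (by simp) (fun u ε hε => by
        have h1 := hlim u ε hε
        rw [truncIlam_of_not_aestronglyMeasurable hε hg₀] at h1
        simpa [truncIlam] using h1)
    simp_rw [Ilam_of_not_aestronglyMeasurable hg₀]
    simpa [Ilam] using h
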